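/- For every t ∈ (−2, −1), one has R₃(t) > 0, i.e. log|Γ₃(1+t)| > 0 on (−2,−1). -/

import Mathlib

open Complex Filter Topology Set

noncomputable section

/-- Euler–Mascheroni constant. -/
def γ : ℝ := Real.eulerMascheroniConstant

/-- The constant `D`. -/
def Dc : ℝ := -(1/6) * (γ + Real.pi^2/6 + 3/2)

/-- The constant `E`. -/
def Ec : ℝ := (1/4) * (γ + Real.log (2*Real.pi) + 1/2)

/-- The constant `F`, with ζ'(-1) the (real) derivative value of the Riemann zeta function. -/
def Fc : ℝ := 3/8 - Real.log (2*Real.pi)/4 - (1/12 - (deriv riemannZeta (-1)).re)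

/-- The series `log P₃(z)`. -/
def logP3 (z : ℂ) : ℂ :=
  ∑' n : ℕ, (let k : ℂ := (n : ℂ) + 1;
    -(k*(k+1)/2) * Complex.log (1 + z/k) + ((k+1)/2) * z
      - (1/4)*(1 + 1/k) * z^2 + (1/(6*k))*(1 + 1/k) * z^3)

/-- The holomorphic branch `L₃(z)` of `log Γ₃(1+z)`. -/
def L3 (z : ℂ) : ℂ := (Dc : ℂ) * z^3 + (Ec : ℂ) * z^2 + (Fc : ℂ) * z + logP3 z

/-- The real version `R₃(t) = log |Γ₃(1+t)|`. -/
def R3 (t : ℝ) : ℝ :=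
  Dc * t^3 + Ec * t^2 + Fc * t +
  ∑' n : ℕ, (let k : ℝ := (n : ℝ) + 1;
    -(k*(k+1)/2) * Real.log |1 + t/k| + ((k+1)/2) * t
      - (1/4)*(1 + 1/k) * t^2 + (1/(6*k))*(1 + 1/k) * t^3)

/-- The function `f₃`. -/
def f3 (z : ℂ) : ℂ := L3 z / (z^3 * Complex.log z)

/-- The zero counting function `N₃`. -/
def N3 (s : ℝ) : ℝ := (⌊s⌋ : ℝ) * ((⌊s⌋ : ℝ) + 1) * ((⌊s⌋ : ℝ) + 2) / 6

open Classical in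
/-- The density `d̃₃`. -/
def d3tilde (t : ℝ) : ℝ :=
  if t < 0 ∧ ¬ (∃ n : ℕ, t = -((n : ℝ) + 1)) then
    -(R3 t + N3 |t| * Real.log |t|) / (t^3 * ((Real.log |t|)^2 + Real.pi^2))
  else 0

end

open scoped ComplexOrder in
/-- `ζ'(2)` is a nonpositive real number. -/
lemma deriv_riemannZeta_two_nonpos : deriv riemannZeta 2 ≤ 0 := by
  have hpos := LSeries.iteratedDeriv_alternating (a := 1) (fun _ ↦ zero_le_one) (x := 2)
    (by rw [LSeries.abscissaOfAbsConv_one]; exact_mod_cast one_lt_two) 1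
  have heq : LSeries 1 =ᶠ[𝓝 (2 : ℂ)] riemannZeta := by
    filter_upwards [(isOpen_lt continuous_const continuous_re).mem_nhds
      (show (1 : ℝ) < (2 : ℂ).re by simp)] with s hs
    exact LSeries_one_eq_riemannZeta hs
  simpa [iteratedDeriv_one, heq.deriv_eq] using hpos

/-- The value of `ζ'(-1)` obtained by differentiating the functional equation at `2`. -/
lemma deriv_riemannZeta_neg_one :
    deriv riemannZeta (-1) = 1 / 12 * (1 - Real.eulerMascheroniConstant
      - Real.log (2 * Real.pi)) + deriv riemannZeta 2 / (2 * Real.pi ^ 2) := by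
  have hπ : (Real.pi : ℂ) ≠ 0 := by exact_mod_cast Real.pi_ne_zero
  have hpow : HasDerivAt (fun s : ℂ ↦ (2 * Real.pi : ℂ) ^ (-s))
      ((2 * Real.pi : ℂ) ^ (-2 : ℂ) * Complex.log (2 * Real.pi) * (-1)) 2 :=
    (hasDerivAt_neg (2 : ℂ)).const_cpow (Or.inl (by simp [hπ]))
  have hGamma : HasDerivAt Complex.Gamma (1 - Real.eulerMascheroniConstant : ℂ) 2 := by
    have h := Complex.hasDerivAt_Gamma_nat 1
    norm_num [harmonic] at h
    rwa [neg_add_eq_sub] at h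
  have hcos : HasDerivAt (fun s : ℂ ↦ Complex.cos (Real.pi * s / 2)) 0 2 := by
    have h := (((hasDerivAt_id (2 : ℂ)).const_mul (Real.pi : ℂ)).div_const 2).ccos
    simpa using h
  have hzeta := (differentiableAt_riemannZeta (s := 2) (by norm_num)).hasDerivAt
  have hright := (((hpow.const_mul 2).mul hGamma).mul hcos).mul hzeta
  have hleft : HasDerivAt (fun s : ℂ ↦ riemannZeta (1 - s)) (-deriv riemannZeta (-1)) 2 := by
    have h : HasDerivAt riemannZeta (deriv riemannZeta (-1)) (1 - 2) := by
      rw [show (1 - 2 : ℂ) = -1 by norm_num]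
      exact (differentiableAt_riemannZeta (by norm_num)).hasDerivAt
    simpa using h.comp_const_sub 1 2
  have heq : (fun s : ℂ ↦ riemannZeta (1 - s)) =ᶠ[𝓝 2] fun s ↦
      2 * (2 * Real.pi : ℂ) ^ (-s) * Complex.Gamma s * Complex.cos (Real.pi * s / 2)
        * riemannZeta s := by
    filter_upwards [(isOpen_lt continuous_const continuous_re).mem_nhds
      (show (1 : ℝ) < (2 : ℂ).re by simp)] with s hs
    refine riemannZeta_one_sub (fun n hn ↦ ?_) (fun h ↦ ?_)
    · have hneg : 1 < -(n : ℝ) := by simpa [hn] using hs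
      linarith [n.cast_nonneg (α := ℝ)]
    · simp [h] at hs
  have hval := hleft.unique (hright.congr_of_eventuallyEq heq)
  have hΓ : Complex.Gamma 2 = 1 := by simp
  have hc : Complex.cos (Real.pi * 2 / 2) = -1 := by simp
  have hl : Complex.log (2 * Real.pi) = (Real.log (2 * Real.pi) : ℝ) := by
    rw [Complex.ofReal_log (by positivity)]; push_cast; rfl
  have hp : (2 * Real.pi : ℂ) ^ (-2 : ℂ) = 1 / (4 * Real.pi ^ 2) := by
    rw [Complex.cpow_neg, Complex.cpow_ofNat]; ring
  simp only [Pi.mul_apply, hΓ, hc, hl, hp, riemannZeta_two] at hval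
  rw [← neg_neg (deriv riemannZeta (-1)), hval]
  field_simp
  ring

lemma one_lt_log_pi : 1 < Real.log Real.pi := by
  rw [Real.lt_log_iff_exp_lt Real.pi_pos]
  linarith [Real.exp_one_lt_d9, Real.pi_gt_three]

lemma three_halves_lt_log_two_pi : 3 / 2 < Real.log (2 * Real.pi) := by
  rw [Real.log_mul two_ne_zero Real.pi_ne_zero]
  linarith [Real.log_two_gt_d9, one_lt_log_pi]

open scoped ComplexOrder in
lemma re_deriv_riemannZeta_neg_one_nonpos : (deriv riemannZeta (-1)).re ≤ 0 := by
  have h2 : (deriv riemannZeta 2).re ≤ 0 := (Complex.le_def.1 deriv_riemannZeta_two_nonpos).1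
  have hre : (deriv riemannZeta (-1)).re = 1 / 12 * (1 - Real.eulerMascheroniConstant
      - Real.log (2 * Real.pi)) + (deriv riemannZeta 2).re / (2 * Real.pi ^ 2) := by
    rw [deriv_riemannZeta_neg_one, Complex.add_re]
    congr 1
    · rw [← Complex.ofReal_re (1 / 12 * _)]
      push_cast
      rfl
    · rw [← Complex.div_ofReal_re]
      push_cast
      rfl
  have hdiv : (deriv riemannZeta 2).re / (2 * Real.pi ^ 2) ≤ 0 :=
    div_nonpos_of_nonpos_of_nonneg h2 (by positivity)
  linarith [Real.one_half_lt_eulerMascheroniConstant, three_halves_lt_log_two_pi]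

lemma cubic_le_neg_log_one_sub {u : ℝ} (h0 : 0 ≤ u) (h1 : u < 1) :
    u + u ^ 2 / 2 + u ^ 3 / 3 ≤ -Real.log (1 - u) := by
  have h := sum_le_hasSum (Finset.range 3) (fun i _ ↦ by positivity)
    (Real.hasSum_pow_div_log_of_abs_lt_one (abs_lt.2 ⟨by linarith, h1⟩))
  norm_num [Finset.sum_range_succ] at h
  linarith

lemma neg_log_one_sub_le_cubic_add {u : ℝ} (h0 : 0 ≤ u) (h1 : u ≤ 2 / 3) :
    -Real.log (1 - u) ≤ u + u ^ 2 / 2 + u ^ 3 / 3 + 3 * u ^ 4 := by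
  have h := Real.abs_log_sub_add_sum_range_le (abs_lt.2 ⟨by linarith, by linarith⟩ : |u| < 1) 3
  norm_num [Finset.sum_range_succ, abs_of_nonneg h0] at h
  have hle : u ^ 4 / (1 - u) ≤ 3 * u ^ 4 := by
    rw [div_le_iff₀ (by linarith)]
    nlinarith [pow_nonneg h0 4]
  linarith [(abs_le.1 h).1]

/-- The `k`-th summand of the series in `R3`. -/
noncomputable def R3Summand (t k : ℝ) : ℝ :=
  -(k * (k + 1) / 2) * Real.log |1 + t / k| + ((k + 1) / 2) * t
    - (1 / 4) * (1 + 1 / k) * t ^ 2 + (1 / (6 * k)) * (1 + 1 / k) * t ^ 3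

lemma R3Summand_neg {x k : ℝ} (hk : 0 < k) (hxk : x < k) :
    R3Summand (-x) k = k * (k + 1) / 2 *
      (-Real.log (1 - x / k) - (x / k + (x / k) ^ 2 / 2 + (x / k) ^ 3 / 3)) := by
  have hpos : 0 < 1 - x / k := by rw [sub_pos, div_lt_one hk]; exact hxk
  rw [R3Summand, neg_div, ← sub_eq_add_neg, abs_of_pos hpos]
  field_simp
  ring

lemma R3Summand_neg_nonneg {x k : ℝ} (hx : 0 ≤ x) (hxk : x < k) : 0 ≤ R3Summand (-x) k := by
  have hk : 0 < k := hx.trans_lt hxk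
  rw [R3Summand_neg hk hxk]
  have := cubic_le_neg_log_one_sub (div_nonneg hx hk.le) ((div_lt_one hk).2 hxk)
  exact mul_nonneg (by positivity) (sub_nonneg.2 this)

lemma R3Summand_neg_le {x k : ℝ} (hx : 0 ≤ x) (hk : 1 ≤ k) (hxk : x / k ≤ 2 / 3) :
    R3Summand (-x) k ≤ 3 * x ^ 4 / k ^ 2 := by
  have hk0 : 0 < k := by linarith
  rw [R3Summand_neg hk0 ((div_lt_one hk0).1 (by linarith))]
  have h := neg_log_one_sub_le_cubic_add (div_nonneg hx hk0.le) hxk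
  calc _ ≤ k * (k + 1) / 2 * (3 * (x / k) ^ 4) := by gcongr; linarith
    _ ≤ k * (k + k) / 2 * (3 * (x / k) ^ 4) := by gcongr
    _ = 3 * x ^ 4 / k ^ 2 := by field_simp; ring

lemma summable_R3Summand_neg {x : ℝ} (h1 : 1 < x) (h2 : x < 2) :
    Summable fun n : ℕ ↦ R3Summand (-x) (n + 1) := by
  rw [← summable_nat_add_iff 2]
  have hs : Summable fun n : ℕ ↦ 3 * x ^ 4 * (1 / ((n + 3 : ℕ) : ℝ) ^ 2) :=
    (((summable_nat_add_iff 3).2 (Real.summable_one_div_nat_pow.2 one_lt_two)).mul_left _)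
  refine hs.of_nonneg_of_le (fun n ↦ ?_) (fun n ↦ ?_)
  · refine R3Summand_neg_nonneg (by linarith) ?_
    push_cast
    linarith [n.cast_nonneg (α := ℝ)]
  · have hn := n.cast_nonneg (α := ℝ)
    have hk : ((n + 2 : ℕ) : ℝ) + 1 = ((n + 3 : ℕ) : ℝ) := by push_cast; ring
    rw [hk, mul_one_div]
    refine R3Summand_neg_le (by linarith) (by push_cast; linarith) ?_
    rw [div_le_iff₀ (by positivity)]
    push_cast
    linarith

/-- `R₃(t) > 0`, i.e. `log|Γ₃(1+t)| > 0`, on `(−2,−1)`. -/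
theorem R3_pos_on_Ioo_neg_two_neg_one :
    ∀ t ∈ Set.Ioo (-2 : ℝ) (-1), 0 < R3 t := by
  rintro t ⟨ht2, ht1⟩
  obtain ⟨x, rfl⟩ : ∃ x, t = -x := ⟨-t, by ring⟩
  have h1 : 1 < x := by linarith
  have h2 : x < 2 := by linarith
  have hsum : R3Summand (-x) 1 ≤ ∑' n : ℕ, R3Summand (-x) (n + 1) := by
    have h := (summable_R3Summand_neg h1 h2).sum_le_tsum (Finset.range 1) fun n hn ↦ by
      have hn1 : (1 : ℝ) ≤ n := by
        exact_mod_cast Nat.one_le_iff_ne_zero.2 (by simpa using hn)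
      exact R3Summand_neg_nonneg (by linarith) (by linarith)
    simpa using h
  have hfirst : (2 - x) - x - x ^ 2 / 2 - x ^ 3 / 3 ≤ R3Summand (-x) 1 := by
    have habs : |1 + -x / 1| = x - 1 := by rw [div_one, abs_of_neg] <;> linarith
    have hlog := Real.log_le_sub_one_of_pos (sub_pos.2 h1)
    rw [R3Summand, habs]
    linarith
  have hγ : 1 / 2 < γ := Real.one_half_lt_eulerMascheroniConstant
  have hlog := three_halves_lt_log_two_pi
  have hD : Dc ≤ -(7 / 12) := by
    rw [Dc]
    nlinarith [Real.pi_gt_three]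
  have hE : 5 / 8 ≤ Ec := by
    rw [Ec]
    linarith
  have hF : Fc ≤ -(1 / 12) := by
    rw [Fc]
    linarith [re_deriv_riemannZeta_neg_one_nonpos]
  have hD' : 7 / 12 * x ^ 3 ≤ Dc * (-x) ^ 3 := by
    nlinarith [mul_le_mul_of_nonneg_right hD (by positivity : 0 ≤ x ^ 3)]
  have hE' : 5 / 8 * x ^ 2 ≤ Ec * (-x) ^ 2 := by
    nlinarith [mul_le_mul_of_nonneg_right hE (sq_nonneg x)]
  have hF' : 1 / 12 * x ≤ Fc * (-x) := by nlinarith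
  have hpoly : 0 < 1 / 4 * x ^ 3 + 1 / 8 * x ^ 2 - 23 / 12 * x + 2 := by
    nlinarith [mul_nonneg (by linarith : (0 : ℝ) ≤ x) (sq_nonneg (x - 7 / 5)),
      sq_nonneg (x - 7 / 5)]
  have hR : R3 (-x) = Dc * (-x) ^ 3 + Ec * (-x) ^ 2 + Fc * (-x)
      + ∑' n : ℕ, R3Summand (-x) (n + 1) := rfl
  rw [hR]
  linarith
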